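/- For the metric ds² = 2 du dv + √(u v^{-3}) dv² + v² e^{g(x,y)}(dx² + dy²), the only potentially non-vanishing curvature components (up to algebraic symmetries) are R_{1212} = 1/(8w³), R_{2323} = R_{2424} = −e^{g(x,y)}/(4w), and R_{3434} = −(v²/2) e^{g(x,y)} ∇²g, where w = √(uv) and ∇²g = ∂²g/∂x² + ∂²g/∂y². In particular, R_{abcd} l^d never vanishes for l = ∂/∂u, so l is not covariantly constant on any nonempty open subset. -/

import Mathlib

open scoped BigOperators

/-- Partial derivative in the `i`-th coordinate direction of a function on ℝ⁴. -/
noncomputable def pd (i : Fin 4) (f : (Fin 4 → ℝ) → ℝ) (q : Fin 4 → ℝ) : ℝ :=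
  fderiv ℝ f q (Pi.single i 1)

/-- Christoffel symbols `Γ^a_{bc}` of the Levi-Civita connection of the metric
field `g`. -/
noncomputable def christoffel (g : (Fin 4 → ℝ) → Matrix (Fin 4) (Fin 4) ℝ)
    (a b c : Fin 4) (q : Fin 4 → ℝ) : ℝ :=
  (1 / 2) * ∑ d, (g q)⁻¹ a d *
    (pd b (fun r => g r d c) q + pd c (fun r => g r d b) q - pd d (fun r => g r b c) q)

/-- Covariant derivative `ω_{a;b}` of a covector field `ω`. -/
noncomputable def covD1 (g : (Fin 4 → ℝ) → Matrix (Fin 4) (Fin 4) ℝ)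
    (ω : Fin 4 → (Fin 4 → ℝ) → ℝ) (a b : Fin 4) (q : Fin 4 → ℝ) : ℝ :=
  pd b (ω a) q - ∑ c, christoffel g c a b q * ω c q

/-- Covariant derivative `T_{ab;c}` of a (0,2) tensor field `T`. -/
noncomputable def covD2 (g : (Fin 4 → ℝ) → Matrix (Fin 4) (Fin 4) ℝ)
    (T : Fin 4 → Fin 4 → (Fin 4 → ℝ) → ℝ) (a b c : Fin 4) (q : Fin 4 → ℝ) : ℝ :=
  pd c (T a b) q - ∑ d, christoffel g d a c q * T d b q
    - ∑ d, christoffel g d b c q * T a d q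

/-- The metric `ds² = 2 du dv + √(u v⁻³) dv² + v² e^{g(x,y)} (dx² + dy²)` in
coordinates `(x¹,x²,x³,x⁴) = (u,v,x,y) = (q 0, q 1, q 2, q 3)`. -/
noncomputable def gmet (gf : ℝ → ℝ → ℝ) (q : Fin 4 → ℝ) :
    Matrix (Fin 4) (Fin 4) ℝ :=
  !![0, 1, 0, 0;
     1, Real.sqrt (q 0 / (q 1) ^ 3), 0, 0;
     0, 0, (q 1) ^ 2 * Real.exp (gf (q 2) (q 3)), 0;
     0, 0, 0, (q 1) ^ 2 * Real.exp (gf (q 2) (q 3))]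

/-- The vector field `l = ∂/∂u`, with components `l^a = (1,0,0,0)`. -/
def lvec : Fin 4 → ℝ := ![1, 0, 0, 0]

/-- The lowered covector field `l_a = g_{ab} l^b` associated to `l = ∂/∂u`. -/
noncomputable def llow (gf : ℝ → ℝ → ℝ) (a : Fin 4) (q : Fin 4 → ℝ) : ℝ :=
  ∑ b, gmet gf q a b * lvec b

/-- The curvature tensor `R^d{}_{abc}` of the Levi-Civita connection of `g`. -/
noncomputable def riemannUp (g : (Fin 4 → ℝ) → Matrix (Fin 4) (Fin 4) ℝ)
    (d a b c : Fin 4) (q : Fin 4 → ℝ) : ℝ :=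
  pd b (fun r => christoffel g d a c r) q - pd c (fun r => christoffel g d a b r) q
    + ∑ e, christoffel g d e b q * christoffel g e a c q
    - ∑ e, christoffel g d e c q * christoffel g e a b q

/-- The fully covariant curvature tensor `R_{abcd} = g_{ae} R^e{}_{bcd}`. -/
noncomputable def riemannLow (g : (Fin 4 → ℝ) → Matrix (Fin 4) (Fin 4) ℝ)
    (a b c d : Fin 4) (q : Fin 4 → ℝ) : ℝ :=
  ∑ e, g q a e * riemannUp g e b c d q

/-- The Laplacian `∇²g = ∂²g/∂x² + ∂²g/∂y²` of the metric function `g(x,y)`. -/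
noncomputable def lapgf (gf : ℝ → ℝ → ℝ) (x y : ℝ) : ℝ :=
  deriv (fun t => deriv (fun s => gf s y) t) x +
    deriv (fun t => deriv (fun s => gf x s) t) y


/-- `f` is differentiable at `q` with partial derivatives `D`. -/
def HP (f : (Fin 4 → ℝ) → ℝ) (q : Fin 4 → ℝ) (D : Fin 4 → ℝ) : Prop :=
  HasFDerivAt f (∑ i, D i • (ContinuousLinearMap.proj i : (Fin 4 → ℝ) →L[ℝ] ℝ)) q

theorem HP.pd {f q D} (h : HP f q D) (i : Fin 4) : pd i f q = D i := by
  unfold _root_.pd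
  rw [HasFDerivAt.fderiv h]
  fin_cases i <;> simp [Fin.sum_univ_four]

theorem HP.congr {f q D D'} (h : HP f q D) (e : ∀ i, D i = D' i) : HP f q D' := by
  have : D = D' := funext e
  rwa [← this]

theorem HP.const (c : ℝ) (q) : HP (fun _ => c) q (fun _ => 0) := by
  unfold HP
  simpa using hasFDerivAt_const c q

theorem HP.coord (j : Fin 4) (q) : HP (fun r => r j) q (fun i => if i = j then 1 else 0) := by
  unfold HP
  simpa using (hasFDerivAt_apply (𝕜 := ℝ) j q)

theorem HP.add {f g q D E} (hf : HP f q D) (hg : HP g q E) :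
    HP (fun r => f r + g r) q (fun i => D i + E i) := by
  unfold HP at *
  refine (hf.fun_add hg).congr_fderiv ?_
  simp [add_smul, Finset.sum_add_distrib]

theorem HP.mul {f g q D E} (hf : HP f q D) (hg : HP g q E) :
    HP (fun r => f r * g r) q (fun i => f q * E i + g q * D i) := by
  unfold HP at *
  refine (hf.fun_mul hg).congr_fderiv ?_
  simp [add_smul, Finset.sum_add_distrib, Finset.smul_sum, smul_smul]

theorem HP.comp {f : (Fin 4 → ℝ) → ℝ} {q D} (φ : ℝ → ℝ) (φ' : ℝ) (hφ : HasDerivAt φ φ' (f q))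
    (hf : HP f q D) : HP (fun r => φ (f r)) q (fun i => φ' * D i) := by
  unfold HP at *
  refine (hφ.comp_hasFDerivAt q hf).congr_fderiv ?_
  simp [Finset.smul_sum, smul_smul]

theorem HP.of_diff {f : (Fin 4 → ℝ) → ℝ} {q} (hf : DifferentiableAt ℝ f q) :
    HP f q (fun i => _root_.pd i f q) := by
  unfold HP
  refine hf.hasFDerivAt.congr_fderiv ?_
  refine ContinuousLinearMap.ext fun v => ?_
  have : v = ∑ i, v i • (Pi.single i (1 : ℝ) : Fin 4 → ℝ) := by
    ext j
    simp [Finset.sum_apply, Pi.single_apply]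
  conv_lhs => rw [this]
  simp [map_sum, _root_.pd, mul_comm]

theorem pd_eq_deriv {f : (Fin 4 → ℝ) → ℝ} {q} (i : Fin 4) (hf : DifferentiableAt ℝ f q) :
    pd i f q = deriv (fun t => f (Function.update q i t)) (q i) := by
  have h1 : HasDerivAt (Function.update q i) (Pi.single i (1 : ℝ)) (q i) :=
    hasDerivAt_update q i (q i)
  have h2 : HasFDerivAt f (fderiv ℝ f q) (Function.update q i (q i)) := by
    rw [Function.update_eq_self]; exact hf.hasFDerivAt
  exact (h2.comp_hasDerivAt (q i) h1).deriv.symm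

theorem pd_comm {f : (Fin 4 → ℝ) → ℝ} (hf : ContDiff ℝ (⊤ : ℕ∞) f) (i j : Fin 4) (q) :
    pd i (fun r => pd j f r) q = pd j (fun r => pd i f r) q := by
  have hd : DifferentiableAt ℝ (fderiv ℝ f) q :=
    ((hf.fderiv_right (m := 1) (by norm_cast)).differentiable (by norm_num)) q
  have key : ∀ k l : Fin 4, pd k (fun r => pd l f r) q
      = fderiv ℝ (fderiv ℝ f) q (Pi.single k 1) (Pi.single l 1) := by
    intro k l
    unfold pd
    rw [fderiv_clm_apply hd (differentiableAt_const _)]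
    simp
  rw [key, key]
  have hs : IsSymmSndFDerivAt ℝ f q :=
    hf.contDiffAt.isSymmSndFDerivAt (by simp; norm_cast)
  exact hs _ _

theorem pd_smooth {f : (Fin 4 → ℝ) → ℝ} (hf : ContDiff ℝ (⊤ : ℕ∞) f) (i : Fin 4) :
    ContDiff ℝ (⊤ : ℕ∞) (fun r => pd i f r) := by
  unfold pd
  exact (hf.fderiv_right (m := (⊤ : ℕ∞)) (by simp)).clm_apply contDiff_const

/-- `g` as a function on ℝ⁴. -/
def GG (gf : ℝ → ℝ → ℝ) (q : Fin 4 → ℝ) : ℝ := gf (q 2) (q 3)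

theorem GG_smooth {gf : ℝ → ℝ → ℝ}
    (hgf : ContDiff ℝ (⊤ : ℕ∞) (fun p : ℝ × ℝ => gf p.1 p.2)) :
    ContDiff ℝ (⊤ : ℕ∞) (GG gf) := by
  have : ContDiff ℝ (⊤ : ℕ∞) (fun q : Fin 4 → ℝ => (q 2, q 3)) := by fun_prop
  exact hgf.comp this

noncomputable def GX (gf : ℝ → ℝ → ℝ) (q : Fin 4 → ℝ) : ℝ := pd 2 (GG gf) q
noncomputable def GY (gf : ℝ → ℝ → ℝ) (q : Fin 4 → ℝ) : ℝ := pd 3 (GG gf) q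
noncomputable def GXX (gf : ℝ → ℝ → ℝ) (q : Fin 4 → ℝ) : ℝ := pd 2 (GX gf) q
noncomputable def GXY (gf : ℝ → ℝ → ℝ) (q : Fin 4 → ℝ) : ℝ := pd 3 (GX gf) q
noncomputable def GYY (gf : ℝ → ℝ → ℝ) (q : Fin 4 → ℝ) : ℝ := pd 3 (GY gf) q

theorem pd0_GG {gf : ℝ → ℝ → ℝ}
    (hgf : ContDiff ℝ (⊤ : ℕ∞) (fun p : ℝ × ℝ => gf p.1 p.2)) (q) : pd 0 (GG gf) q = 0 := by
  rw [pd_eq_deriv _ ((GG_smooth hgf).differentiable (by simp) q)]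
  simp [GG, Function.update]

theorem pd1_GG {gf : ℝ → ℝ → ℝ}
    (hgf : ContDiff ℝ (⊤ : ℕ∞) (fun p : ℝ × ℝ => gf p.1 p.2)) (q) : pd 1 (GG gf) q = 0 := by
  rw [pd_eq_deriv _ ((GG_smooth hgf).differentiable (by simp) q)]
  simp [GG, Function.update]

theorem HP_GG {gf : ℝ → ℝ → ℝ}
    (hgf : ContDiff ℝ (⊤ : ℕ∞) (fun p : ℝ × ℝ => gf p.1 p.2)) (q) : HP (GG gf) q ![0, 0, GX gf q, GY gf q] := by
  refine (HP.of_diff ((GG_smooth hgf).differentiable (by simp) q)).congr fun i => ?_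
  fin_cases i
  · exact pd0_GG hgf q
  · exact pd1_GG hgf q
  · rfl
  · rfl

theorem HP_GX {gf : ℝ → ℝ → ℝ}
    (hgf : ContDiff ℝ (⊤ : ℕ∞) (fun p : ℝ × ℝ => gf p.1 p.2)) (q) : HP (GX gf) q ![0, 0, GXX gf q, GXY gf q] := by
  refine (HP.of_diff ((pd_smooth (GG_smooth hgf) 2).differentiable (by simp) q)).congr fun i => ?_
  fin_cases i
  · refine (pd_comm (GG_smooth hgf) 0 2 q).trans ?_
    simp only [pd0_GG hgf]
    simp [pd]
  · refine (pd_comm (GG_smooth hgf) 1 2 q).trans ?_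
    simp only [pd1_GG hgf]
    simp [pd]
  · rfl
  · rfl

theorem HP_GY {gf : ℝ → ℝ → ℝ}
    (hgf : ContDiff ℝ (⊤ : ℕ∞) (fun p : ℝ × ℝ => gf p.1 p.2)) (q) : HP (GY gf) q ![0, 0, GXY gf q, GYY gf q] := by
  refine (HP.of_diff ((pd_smooth (GG_smooth hgf) 3).differentiable (by simp) q)).congr fun i => ?_
  fin_cases i
  · refine (pd_comm (GG_smooth hgf) 0 3 q).trans ?_
    simp only [pd0_GG hgf]
    simp [pd]
  · refine (pd_comm (GG_smooth hgf) 1 3 q).trans ?_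
    simp only [pd1_GG hgf]
    simp [pd]
  · exact (pd_comm (GG_smooth hgf) 2 3 q)
  · rfl

theorem lap_eq {gf : ℝ → ℝ → ℝ}
    (hgf : ContDiff ℝ (⊤ : ℕ∞) (fun p : ℝ × ℝ => gf p.1 p.2)) (q) : lapgf gf (q 2) (q 3) = GXX gf q + GYY gf q := by
  have hd : ∀ r, DifferentiableAt ℝ (GG gf) r := (GG_smooth hgf).differentiable (by simp)
  unfold lapgf
  change _ = pd 2 (fun r => pd 2 (GG gf) r) q + pd 3 (fun r => pd 3 (GG gf) r) q
  rw [pd_eq_deriv 2 ((pd_smooth (GG_smooth hgf) 2).differentiable (by simp) q),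
    pd_eq_deriv 3 ((pd_smooth (GG_smooth hgf) 3).differentiable (by simp) q)]
  congr 2
  · funext t
    rw [pd_eq_deriv _ (hd _)]
    simp [GG, Function.update]
  · funext t
    rw [pd_eq_deriv _ (hd _)]
    simp [GG, Function.update]

noncomputable def HH (q : Fin 4 → ℝ) : ℝ := Real.sqrt (q 0 / (q 1) ^ 3)
noncomputable def EE (gf : ℝ → ℝ → ℝ) (q : Fin 4 → ℝ) : ℝ := Real.exp (gf (q 2) (q 3))

theorem HP_inv (j : Fin 4) {q : Fin 4 → ℝ} (h : 0 < q j) :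
    HP (fun r => (r j)⁻¹) q (fun i => if i = j then - (q j ^ 2)⁻¹ else 0) := by
  refine ((HP.coord j q).comp _ _ (hasDerivAt_inv h.ne')).congr fun i => ?_
  split_ifs <;> simp

theorem HH_sq {q : Fin 4 → ℝ} (h0 : 0 < q 0) (h1 : 0 < q 1) : HH q ^ 2 = q 0 / q 1 ^ 3 :=
  Real.sq_sqrt (by positivity)

theorem HH_pos {q : Fin 4 → ℝ} (h0 : 0 < q 0) (h1 : 0 < q 1) : 0 < HH q :=
  Real.sqrt_pos.2 (by positivity)

theorem HP_HH {q : Fin 4 → ℝ} (h0 : 0 < q 0) (h1 : 0 < q 1) :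
    HP HH q ![HH q / (2 * q 0), -3 * HH q / (2 * q 1), 0, 0] := by
  have h := ((HP.coord 0 q).mul ((HP_inv 1 h1).comp (fun t => t ^ 3) _ (hasDerivAt_pow 3 _)))
  have h' := h.comp Real.sqrt _ (Real.hasDerivAt_sqrt (by positivity))
  have e : HH = fun r : Fin 4 → ℝ => Real.sqrt (r 0 * (r 1)⁻¹ ^ 3) := by
    funext r; simp [HH, div_eq_mul_inv]
  have e2 : Real.sqrt (q 0 * (q 1)⁻¹ ^ 3) = HH q := by rw [e]
  rw [e2] at h'
  rw [← e] at h'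
  have hp := HH_pos h0 h1
  have hs := HH_sq h0 h1
  refine h'.congr fun i => ?_
  fin_cases i
  · simp; field_simp; rw [hs]; field_simp
  · simp; field_simp; rw [hs]; field_simp
  · simp
  · simp

theorem HP_EE {gf : ℝ → ℝ → ℝ} (hgf : ContDiff ℝ (⊤ : ℕ∞) (fun p : ℝ × ℝ => gf p.1 p.2)) (q) :
    HP (EE gf) q ![0, 0, EE gf q * GX gf q, EE gf q * GY gf q] := by
  refine ((HP_GG hgf q).comp _ _ (Real.hasDerivAt_exp _)).congr fun i => ?_
  fin_cases i <;> simp [EE, GG]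

noncomputable def PP (gf : ℝ → ℝ → ℝ) (q : Fin 4 → ℝ) : ℝ := q 1 ^ 2 * EE gf q

theorem HP_PP {gf : ℝ → ℝ → ℝ} (hgf : ContDiff ℝ (⊤ : ℕ∞) (fun p : ℝ × ℝ => gf p.1 p.2)) (q) :
    HP (PP gf) q ![0, 2 * q 1 * EE gf q, PP gf q * GX gf q, PP gf q * GY gf q] := by
  refine (((HP.coord 1 q).comp (fun t => t ^ 2) _ (hasDerivAt_pow 2 _)).mul
    (HP_EE hgf q)).congr fun i => ?_
  fin_cases i <;> simp [PP] <;> ring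

/-- The template of Christoffel symbols. -/
def tmpl (A B C V X Y : ℝ) : Fin 4 → Matrix (Fin 4) (Fin 4) ℝ :=
  ![!![0, A, 0, 0; A, B, 0, 0; 0, 0, C, 0; 0, 0, 0, C],
    !![0, 0, 0, 0; 0, -A, 0, 0; 0, 0, 0, 0; 0, 0, 0, 0],
    !![0, 0, 0, 0; 0, 0, V, 0; 0, V, X, Y; 0, 0, Y, -X],
    !![0, 0, 0, 0; 0, 0, 0, V; 0, 0, -Y, X; 0, V, X, Y]]

theorem HP_tmpl {A B C V X Y : (Fin 4 → ℝ) → ℝ} {q dA dB dC dV dX dY}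
    (hA : HP A q dA) (hB : HP B q dB) (hC : HP C q dC) (hV : HP V q dV) (hX : HP X q dX)
    (hY : HP Y q dY) (a b c : Fin 4) :
    HP (fun r => tmpl (A r) (B r) (C r) (V r) (X r) (Y r) a b c) q
      (fun i => tmpl (dA i) (dB i) (dC i) (dV i) (dX i) (dY i) a b c) := by
  have hz := HP.const 0 q
  have neg : ∀ {f D}, HP f q D → HP (fun r => - f r) q (fun i => - D i) := by
    intro f D hf
    simpa using (HP.const (-1) q).mul hf
  have nA := neg hA
  have nX := neg hX
  have nY := neg hY
  fin_cases a <;> fin_cases b <;> fin_cases c <;> assumption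

noncomputable def fA (q : Fin 4 → ℝ) : ℝ := HH q / (4 * q 0)
noncomputable def fB (q : Fin 4 → ℝ) : ℝ := 1 / (4 * q 1 ^ 3) - 3 * HH q / (4 * q 1)
noncomputable def fC (gf : ℝ → ℝ → ℝ) (q : Fin 4 → ℝ) : ℝ := - (q 1 * EE gf q)
noncomputable def fV (q : Fin 4 → ℝ) : ℝ := (q 1)⁻¹
noncomputable def fX (gf : ℝ → ℝ → ℝ) (q : Fin 4 → ℝ) : ℝ := GX gf q / 2
noncomputable def fY (gf : ℝ → ℝ → ℝ) (q : Fin 4 → ℝ) : ℝ := GY gf q / 2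

noncomputable def Gam (gf : ℝ → ℝ → ℝ) (a b c : Fin 4) (q : Fin 4 → ℝ) : ℝ :=
  tmpl (fA q) (fB q) (fC gf q) (fV q) (fX gf q) (fY gf q) a b c

noncomputable def dfA (q : Fin 4 → ℝ) : Fin 4 → ℝ :=
  ![- HH q / (8 * q 0 ^ 2), -3 * HH q / (8 * q 0 * q 1), 0, 0]
noncomputable def dfB (q : Fin 4 → ℝ) : Fin 4 → ℝ :=
  ![-3 * HH q / (8 * q 0 * q 1), -3 / (4 * q 1 ^ 4) + 15 * HH q / (8 * q 1 ^ 2), 0, 0]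
noncomputable def dfC (gf : ℝ → ℝ → ℝ) (q : Fin 4 → ℝ) : Fin 4 → ℝ :=
  ![0, - EE gf q, - (q 1 * EE gf q * GX gf q), - (q 1 * EE gf q * GY gf q)]
noncomputable def dfV (q : Fin 4 → ℝ) : Fin 4 → ℝ := ![0, - (q 1 ^ 2)⁻¹, 0, 0]
noncomputable def dfX (gf : ℝ → ℝ → ℝ) (q : Fin 4 → ℝ) : Fin 4 → ℝ :=
  ![0, 0, GXX gf q / 2, GXY gf q / 2]
noncomputable def dfY (gf : ℝ → ℝ → ℝ) (q : Fin 4 → ℝ) : Fin 4 → ℝ :=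
  ![0, 0, GXY gf q / 2, GYY gf q / 2]

noncomputable def dGam (gf : ℝ → ℝ → ℝ) (i a b c : Fin 4) (q : Fin 4 → ℝ) : ℝ :=
  tmpl (dfA q i) (dfB q i) (dfC gf q i) (dfV q i) (dfX gf q i) (dfY gf q i) a b c

theorem pd_Gam {gf : ℝ → ℝ → ℝ} (hgf : ContDiff ℝ (⊤ : ℕ∞) (fun p : ℝ × ℝ => gf p.1 p.2))
    {q : Fin 4 → ℝ} (h0 : 0 < q 0) (h1 : 0 < q 1) (i a b c : Fin 4) :
    pd i (Gam gf a b c) q = dGam gf i a b c q := by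
  have hA : HP fA q (dfA q) := by
    have := ((HP.const (1/4) q).mul ((HP_HH h0 h1).mul (HP_inv 0 h0)))
    have e : fA = fun r => 1/4 * (HH r * (r 0)⁻¹) := by
      funext r; simp only [fA, div_eq_mul_inv, mul_inv]; ring
    rw [e]
    refine this.congr fun i => ?_
    fin_cases i <;> simp [dfA] <;> field_simp <;> ring
  have hB : HP fB q (dfB q) := by
    have := ((HP.const (1/4) q).mul ((HP_inv 1 h1).comp (fun t => t ^ 3) _ (hasDerivAt_pow 3 _))).add
      ((HP.const (-3/4) q).mul ((HP_HH h0 h1).mul (HP_inv 1 h1)))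
    have e : fB = fun r => 1/4 * ((r 1)⁻¹) ^ 3 + -3/4 * (HH r * (r 1)⁻¹) := by
      funext r; simp only [fB, div_eq_mul_inv, mul_inv, inv_pow]; ring
    rw [e]
    refine this.congr fun i => ?_
    fin_cases i <;> simp [dfB] <;> field_simp <;> ring
  have hC : HP (fC gf) q (dfC gf q) := by
    have := (HP.const (-1) q).mul ((HP.coord 1 q).mul (HP_EE hgf q))
    have e : fC gf = fun r => -1 * (r 1 * EE gf r) := by
      funext r; simp [fC]
    rw [e]
    refine this.congr fun i => ?_
    fin_cases i <;> simp [dfC] <;> ring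
  have hV : HP fV q (dfV q) := by
    refine (HP_inv 1 h1).congr fun i => ?_
    fin_cases i <;> simp [dfV]
  have hX : HP (fX gf) q (dfX gf q) := by
    have := (HP.const (1/2) q).mul (HP_GX hgf q)
    have e : fX gf = fun r => 1/2 * GX gf r := by
      funext r; simp only [fX]; ring
    rw [e]
    refine this.congr fun i => ?_
    fin_cases i <;> simp [dfX] <;> ring
  have hY : HP (fY gf) q (dfY gf q) := by
    have := (HP.const (1/2) q).mul (HP_GY hgf q)
    have e : fY gf = fun r => 1/2 * GY gf r := by
      funext r; simp only [fY]; ring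
    rw [e]
    refine this.congr fun i => ?_
    fin_cases i <;> simp [dfY] <;> ring
  exact (HP_tmpl hA hB hC hV hX hY a b c).pd i

/-- Template of the metric. -/
def mtm (o H P : ℝ) : Matrix (Fin 4) (Fin 4) ℝ :=
  !![0, o, 0, 0; o, H, 0, 0; 0, 0, P, 0; 0, 0, 0, P]

theorem gmet_eq (gf : ℝ → ℝ → ℝ) (q) : gmet gf q = mtm 1 (HH q) (PP gf q) := rfl

theorem pd_met {gf : ℝ → ℝ → ℝ} (hgf : ContDiff ℝ (⊤ : ℕ∞) (fun p : ℝ × ℝ => gf p.1 p.2))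
    {q : Fin 4 → ℝ} (h0 : 0 < q 0) (h1 : 0 < q 1) (i a b : Fin 4) :
    pd i (fun r => gmet gf r a b) q =
      mtm 0 ((![HH q / (2 * q 0), -3 * HH q / (2 * q 1), 0, 0] : Fin 4 → ℝ) i)
        ((![0, 2 * q 1 * EE gf q, PP gf q * GX gf q, PP gf q * GY gf q] : Fin 4 → ℝ) i) a b := by
  have hz := HP.const 0 q
  have ho := HP.const 1 q
  have hH := HP_HH h0 h1
  have hP := HP_PP hgf q
  fin_cases a <;> fin_cases b <;> first
    | exact hz.pd i | exact ho.pd i | exact hH.pd i | exact hP.pd i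

theorem inv_met {gf : ℝ → ℝ → ℝ} {q : Fin 4 → ℝ} (h1 : 0 < q 1) :
    (gmet gf q)⁻¹ = !![-HH q, 1, 0, 0; 1, 0, 0, 0; 0, 0, (PP gf q)⁻¹, 0; 0, 0, 0, (PP gf q)⁻¹] := by
  have hP : PP gf q ≠ 0 := by
    have : 0 < EE gf q := Real.exp_pos _
    unfold PP; positivity
  apply Matrix.inv_eq_right_inv
  rw [gmet_eq]
  ext i j
  fin_cases i <;> fin_cases j <;> simp [mtm, Matrix.mul_apply, Fin.sum_univ_four, hP]

theorem chr_eq {gf : ℝ → ℝ → ℝ} (hgf : ContDiff ℝ (⊤ : ℕ∞) (fun p : ℝ × ℝ => gf p.1 p.2))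
    {q : Fin 4 → ℝ} (h0 : 0 < q 0) (h1 : 0 < q 1) (a b c : Fin 4) :
    christoffel (gmet gf) a b c q = Gam gf a b c q := by
  have hE : 0 < EE gf q := Real.exp_pos _
  have hs' : HH q ^ 2 * q 1 ^ 3 = q 0 := by rw [HH_sq h0 h1]; field_simp
  unfold christoffel
  simp only [pd_met hgf h0 h1, inv_met h1, Fin.sum_univ_four]
  fin_cases a <;> fin_cases b <;> fin_cases c <;>
    simp [mtm, Gam, tmpl, fA, fB, fC, fV, fX, fY, PP] <;> field_simp <;>
    first | done | ring1 | linear_combination hs' | linear_combination 4 * hs'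

theorem pd_chr {gf : ℝ → ℝ → ℝ} (hgf : ContDiff ℝ (⊤ : ℕ∞) (fun p : ℝ × ℝ => gf p.1 p.2))
    {q : Fin 4 → ℝ} (h0 : 0 < q 0) (h1 : 0 < q 1) (i a b c : Fin 4) :
    pd i (fun r => christoffel (gmet gf) a b c r) q = dGam gf i a b c q := by
  rw [← pd_Gam hgf h0 h1]
  unfold pd
  have : (fun r => christoffel (gmet gf) a b c r) =ᶠ[nhds q] Gam gf a b c := by
    have e0 : ∀ᶠ r : Fin 4 → ℝ in nhds q, 0 < r 0 :=
      (continuous_apply 0).continuousAt.eventually (lt_mem_nhds h0)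
    have e1 : ∀ᶠ r : Fin 4 → ℝ in nhds q, 0 < r 1 :=
      (continuous_apply 1).continuousAt.eventually (lt_mem_nhds h1)
    filter_upwards [e0, e1] with r r0 r1 using chr_eq hgf r0 r1 a b c
  rw [this.fderiv_eq]

theorem riem_up {gf : ℝ → ℝ → ℝ} (hgf : ContDiff ℝ (⊤ : ℕ∞) (fun p : ℝ × ℝ => gf p.1 p.2))
    {q : Fin 4 → ℝ} (h0 : 0 < q 0) (h1 : 0 < q 1) (d a b c : Fin 4) :
    riemannUp (gmet gf) d a b c q = dGam gf b d a c q - dGam gf c d a b q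
      + ∑ e, Gam gf d e b q * Gam gf e a c q - ∑ e, Gam gf d e c q * Gam gf e a b q := by
  unfold riemannUp
  simp only [pd_chr hgf h0 h1, chr_eq hgf h0 h1]

theorem HH_w {q : Fin 4 → ℝ} (h0 : 0 < q 0) (h1 : 0 < q 1) :
    HH q = q 0 / (q 1 * Real.sqrt (q 0 * q 1)) := by
  unfold HH
  rw [Real.sqrt_eq_iff_mul_self_eq (by positivity) (by positivity)]
  have hw : Real.sqrt (q 0 * q 1) ^ 2 = q 0 * q 1 := Real.sq_sqrt (by positivity)
  have : 0 < Real.sqrt (q 0 * q 1) := Real.sqrt_pos.2 (by positivity)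
  field_simp
  rw [hw]

theorem riem_low {gf : ℝ → ℝ → ℝ} (hgf : ContDiff ℝ (⊤ : ℕ∞) (fun p : ℝ × ℝ => gf p.1 p.2))
    {q : Fin 4 → ℝ} (h0 : 0 < q 0) (h1 : 0 < q 1) (a b c d : Fin 4) :
    riemannLow (gmet gf) a b c d q = ∑ f, mtm 1 (HH q) (PP gf q) a f *
      (dGam gf c f b d q - dGam gf d f b c q
      + ∑ e, Gam gf f e c q * Gam gf e b d q - ∑ e, Gam gf f e d q * Gam gf e b c q) := by
  unfold riemannLow
  simp only [riem_up hgf h0 h1, gmet_eq]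

theorem R0101 {gf : ℝ → ℝ → ℝ} (hgf : ContDiff ℝ (⊤ : ℕ∞) (fun p : ℝ × ℝ => gf p.1 p.2))
    {q : Fin 4 → ℝ} (h0 : 0 < q 0) (h1 : 0 < q 1) :
    riemannLow (gmet gf) 0 1 0 1 q = 1 / (8 * (Real.sqrt (q 0 * q 1)) ^ 3) := by
  have hw : Real.sqrt (q 0 * q 1) ^ 2 = q 0 * q 1 := Real.sq_sqrt (by positivity)
  have hp : 0 < Real.sqrt (q 0 * q 1) := Real.sqrt_pos.2 (by positivity)
  rw [riem_low hgf h0 h1]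
  simp [Fin.sum_univ_four, mtm, dGam, Gam, tmpl, dfA, HH_w h0 h1]
  field_simp
  linear_combination hw

theorem R0110 {gf : ℝ → ℝ → ℝ} (hgf : ContDiff ℝ (⊤ : ℕ∞) (fun p : ℝ × ℝ => gf p.1 p.2))
    {q : Fin 4 → ℝ} (h0 : 0 < q 0) (h1 : 0 < q 1) :
    riemannLow (gmet gf) 0 1 1 0 q = - riemannLow (gmet gf) 0 1 0 1 q := by
  rw [riem_low hgf h0 h1, riem_low hgf h0 h1]
  simp only [Fin.sum_univ_four]
  ring

theorem R1212 {gf : ℝ → ℝ → ℝ} (hgf : ContDiff ℝ (⊤ : ℕ∞) (fun p : ℝ × ℝ => gf p.1 p.2))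
    {q : Fin 4 → ℝ} (h0 : 0 < q 0) (h1 : 0 < q 1) :
    riemannLow (gmet gf) 1 2 1 2 q =
        -Real.exp (gf (q 2) (q 3)) / (4 * Real.sqrt (q 0 * q 1)) := by
  have hw : Real.sqrt (q 0 * q 1) ^ 2 = q 0 * q 1 := Real.sq_sqrt (by positivity)
  have hp : 0 < Real.sqrt (q 0 * q 1) := Real.sqrt_pos.2 (by positivity)
  rw [riem_low hgf h0 h1]
  change _ = -EE gf q / _
  simp [Fin.sum_univ_four, mtm, dGam, Gam, tmpl, dfA, dfB, dfC, dfV, dfX, dfY,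
    fA, fB, fC, fV, fX, fY, PP, HH_w h0 h1]
  field_simp
  ring

theorem R1313 {gf : ℝ → ℝ → ℝ} (hgf : ContDiff ℝ (⊤ : ℕ∞) (fun p : ℝ × ℝ => gf p.1 p.2))
    {q : Fin 4 → ℝ} (h0 : 0 < q 0) (h1 : 0 < q 1) :
    riemannLow (gmet gf) 1 3 1 3 q =
        -Real.exp (gf (q 2) (q 3)) / (4 * Real.sqrt (q 0 * q 1)) := by
  have hw : Real.sqrt (q 0 * q 1) ^ 2 = q 0 * q 1 := Real.sq_sqrt (by positivity)
  have hp : 0 < Real.sqrt (q 0 * q 1) := Real.sqrt_pos.2 (by positivity)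
  rw [riem_low hgf h0 h1]
  change _ = -EE gf q / _
  simp [Fin.sum_univ_four, mtm, dGam, Gam, tmpl, dfA, dfB, dfC, dfV, dfX, dfY,
    fA, fB, fC, fV, fX, fY, PP, HH_w h0 h1]
  field_simp
  ring

theorem R2323 {gf : ℝ → ℝ → ℝ} (hgf : ContDiff ℝ (⊤ : ℕ∞) (fun p : ℝ × ℝ => gf p.1 p.2))
    {q : Fin 4 → ℝ} (h0 : 0 < q 0) (h1 : 0 < q 1) :
    riemannLow (gmet gf) 2 3 2 3 q =
        -((q 1) ^ 2 / 2) * Real.exp (gf (q 2) (q 3)) * lapgf gf (q 2) (q 3) := by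
  rw [riem_low hgf h0 h1, lap_eq hgf]
  change _ = _ * EE gf q * _
  simp [Fin.sum_univ_four, mtm, dGam, Gam, tmpl, dfA, dfB, dfC, dfV, dfX, dfY,
    fA, fB, fC, fV, fX, fY, PP]
  field_simp
  ring

set_option maxHeartbeats 4000000 in
theorem Rzero {gf : ℝ → ℝ → ℝ} (hgf : ContDiff ℝ (⊤ : ℕ∞) (fun p : ℝ × ℝ => gf p.1 p.2))
    {q : Fin 4 → ℝ} (h0 : 0 < q 0) (h1 : 0 < q 1) (a b c d : Fin 4)
    (h : ¬ (({a, b} : Finset (Fin 4)) = {c, d} ∧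
           ({a, b} : Finset (Fin 4)) ∈
             ({{0, 1}, {1, 2}, {1, 3}, {2, 3}} : Finset (Finset (Fin 4))))) :
    riemannLow (gmet gf) a b c d q = 0 := by

  rw [riem_low hgf h0 h1]
  fin_cases a <;> fin_cases b <;> fin_cases c <;> fin_cases d <;>
    first
    | (exfalso; revert h; decide)
    | (clear h
       simp [Fin.sum_univ_four, mtm, dGam, Gam, tmpl, dfA, dfB, dfC, dfV, dfX, dfY,
        fA, fB, fC, fV, fX, fY, PP]
       done)
    | (clear h
       simp [Fin.sum_univ_four, mtm, dGam, Gam, tmpl, dfA, dfB, dfC, dfV, dfX, dfY,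
        fA, fB, fC, fV, fX, fY, PP]
       ring_nf
       done)
    | (clear h
       simp [Fin.sum_univ_four, mtm, dGam, Gam, tmpl, dfA, dfB, dfC, dfV, dfX, dfY,
        fA, fB, fC, fV, fX, fY, PP]
       field_simp
       first | done | ring1 | (right; ring1))

/-- for the metric (10), the only potentially non-vanishing curvature
components (up to algebraic symmetries) are `R_{1212} = 1/(8w³)`,
`R_{2323} = R_{2424} = −e^{g}/(4w)` and `R_{3434} = −(v²/2)e^{g}∇²g` (here with
0-based indices: `R_{0101}`, `R_{1212} = R_{1313}`, `R_{2323}`), where `w = √(uv)`.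
In particular `R_{abcd} l^d` never vanishes for `l = ∂/∂u`, so `l` is not
covariantly constant on any nonempty open subset of the domain. -/
theorem curvature_components (gf : ℝ → ℝ → ℝ)
    (hgf : ContDiff ℝ (⊤ : ℕ∞) (fun p : ℝ × ℝ => gf p.1 p.2)) :
    (∀ q : Fin 4 → ℝ, 0 < q 0 → 0 < q 1 →
      riemannLow (gmet gf) 0 1 0 1 q = 1 / (8 * (Real.sqrt (q 0 * q 1)) ^ 3) ∧
      riemannLow (gmet gf) 1 2 1 2 q =
        -Real.exp (gf (q 2) (q 3)) / (4 * Real.sqrt (q 0 * q 1)) ∧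
      riemannLow (gmet gf) 1 3 1 3 q =
        -Real.exp (gf (q 2) (q 3)) / (4 * Real.sqrt (q 0 * q 1)) ∧
      riemannLow (gmet gf) 2 3 2 3 q =
        -((q 1) ^ 2 / 2) * Real.exp (gf (q 2) (q 3)) * lapgf gf (q 2) (q 3) ∧
      (∀ a b c d : Fin 4,
        ¬ (({a, b} : Finset (Fin 4)) = {c, d} ∧
           ({a, b} : Finset (Fin 4)) ∈
             ({{0, 1}, {1, 2}, {1, 3}, {2, 3}} : Finset (Finset (Fin 4)))) →
        riemannLow (gmet gf) a b c d q = 0) ∧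
      (∃ a b c : Fin 4, (∑ d, riemannLow (gmet gf) a b c d q * lvec d) ≠ 0)) ∧
    (∀ U : Set (Fin 4 → ℝ), IsOpen U → U.Nonempty →
      (∀ q ∈ U, 0 < q 0 ∧ 0 < q 1) →
      ¬ (∀ q ∈ U, ∀ a b, covD1 (gmet gf) (llow gf) a b q = 0)) := by
  refine ⟨fun q h0 h1 => ⟨R0101 hgf h0 h1, R1212 hgf h0 h1, R1313 hgf h0 h1, R2323 hgf h0 h1,
    fun a b c d h => Rzero hgf h0 h1 a b c d h, 0, 1, 1, ?_⟩, ?_⟩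
  · have hp : 0 < Real.sqrt (q 0 * q 1) := Real.sqrt_pos.2 (by positivity)
    simp only [Fin.sum_univ_four, lvec, R0110 hgf h0 h1, R0101 hgf h0 h1]
    simp
    exact hp.ne'
  · rintro U - ⟨q, hq⟩ hU hcov
    obtain ⟨h0, h1⟩ := hU q hq
    have h := hcov q hq 1 1
    have hl : ∀ a, llow gf a = fun _ => (![0, 1, 0, 0] : Fin 4 → ℝ) a := by
      intro a
      funext r
      fin_cases a <;> simp [llow, gmet, lvec, Fin.sum_univ_four]
    have hp := HH_pos h0 h1
    have hA : 0 < fA q := by unfold fA; positivity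
    simp [covD1, hl, chr_eq hgf h0 h1, Fin.sum_univ_four, Gam, tmpl, pd] at h
    exact hA.ne' h
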